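/- Let R be a π-adically complete, π-torsion-free commutative ring (π ∈ R a non-zero-divisor) and f ∈ R. Let R̄ be the integral closure of R in R[1/π], let S = R⟨1/f⟩ be the π-adic completion of R[1/f], and let S̄ be the integral closure of S in S[1/π]. Then the π-adic completion of the localization R̄[1/f] is canonically isomorphic to the π-adic completion of S̄; equivalently, for every k ≥ 1 the natural map induces an isomorphism (R̄/π^k R̄)[1/f] ≅ S̄/π^k S̄. -/

import Mathlib

/-- The integral closure of `A` in `A[1/σ]`. -/
noncomputable abbrev intClAway (A : Type*) [CommRing A] (σ : A) :
    Subalgebra A (Localization.Away σ) :=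
  integralClosure A (Localization.Away σ)

/-- The `σ`-adic completion of the integral closure of `A` in `A[1/σ]` (completion with
respect to the ideal generated by the image of `σ`). -/
noncomputable abbrev intClAwayCompl (A : Type*) [CommRing A] (σ : A) : Type _ :=
  AdicCompletion (Ideal.span {algebraMap A (intClAway A σ) σ}) (intClAway A σ)

/-- The natural map from `A` to the completion of the integral closure of `A` in `A[1/σ]`. -/
noncomputable abbrev fromBase (A : Type*) [CommRing A] (σ : A) : A →+* intClAwayCompl A σ :=
  (algebraMap (intClAway A σ) (intClAwayCompl A σ)).comp (algebraMap A (intClAway A σ))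

/-- `A⟨1/g⟩`: the `σ`-adic completion of the localization `A[1/g]`. -/
noncomputable abbrev piComplAway (A : Type*) [CommRing A] (σ g : A) : Type _ :=
  AdicCompletion (Ideal.span {algebraMap A (Localization.Away g) σ}) (Localization.Away g)

/-- The image of `σ` in `A⟨1/g⟩`. -/
noncomputable abbrev piInComplAway (A : Type*) [CommRing A] (σ g : A) : piComplAway A σ g :=
  algebraMap (Localization.Away g) (piComplAway A σ g) (algebraMap A (Localization.Away g) σ)

namespace AdicCompletion

variable {A B C : Type*} [CommRing A] [CommRing B] [CommRing C]

theorem evalₐ_algebraMap (I : Ideal A) (n : ℕ) (a : A) :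
    evalₐ I n (algebraMap A (AdicCompletion I A) a) = Ideal.Quotient.mk (I ^ n) a :=
  evalₐ_of I n a

theorem factorPow_evalₐ (I : Ideal A) {m n : ℕ} (h : m ≤ n) (x : AdicCompletion I A) :
    Ideal.Quotient.factorPow I h (evalₐ I n x) = evalₐ I m x := by
  induction x using induction_on with
  | _ x =>
    simp only [evalₐ_mk, Ideal.Quotient.factor_mk]
    exact Ideal.mk_eq_mk I h x

theorem exists_eq_algebraMap_add (a : A) (n : ℕ)
    (x : AdicCompletion (Ideal.span {a}) A) :
    ∃ b y, x = algebraMap A _ b + algebraMap A (AdicCompletion (Ideal.span {a}) A) a ^ n * y := by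
  obtain ⟨b, hb⟩ := Submodule.mkQ_surjective _ (eval (Ideal.span {a}) A n x)
  have hx : x - algebraMap A _ b ∈ (eval (Ideal.span {a}) A n).ker := by
    rw [LinearMap.mem_ker, map_sub, ← hb]
    exact sub_self _
  rw [← pow_smul_top_eq_ker_eval ⟨{a}, by simp⟩, Ideal.span_singleton_pow,
    Submodule.ideal_span_singleton_smul] at hx
  obtain ⟨y, -, hy⟩ := hx
  refine ⟨b, y, ?_⟩
  rw [← map_pow, ← Algebra.smul_def, eq_comm, add_comm, ← eq_sub_iff_add_eq]
  exact hy

theorem pow_dvd_of_algebraMap_eq {a b : A} {n : ℕ} {y : AdicCompletion (Ideal.span {a}) A}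
    (h : algebraMap A _ b = algebraMap A (AdicCompletion (Ideal.span {a}) A) a ^ n * y) :
    a ^ n ∣ b := by
  have := congrArg (evalₐ _ n) h
  rw [← map_pow, map_mul, evalₐ_algebraMap, evalₐ_algebraMap,
    Ideal.Quotient.eq_zero_iff_mem (a := a ^ n) |>.2
      (Ideal.pow_mem_pow (Ideal.mem_span_singleton_self a) n), zero_mul,
    Ideal.Quotient.eq_zero_iff_mem, Ideal.span_singleton_pow, Ideal.mem_span_singleton] at this
  exact this

theorem algebraMap_mem_nonZeroDivisors {a : A} (ha : a ∈ nonZeroDivisors A) :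
    algebraMap A (AdicCompletion (Ideal.span {a}) A) a ∈ nonZeroDivisors _ := by
  rw [mem_nonZeroDivisors_iff_right]
  intro x hx
  refine ext_evalₐ fun n ↦ ?_
  obtain ⟨b, y, rfl⟩ := exists_eq_algebraMap_add a n x
  obtain ⟨c, hc⟩ : a ^ (n + 1) ∣ b * a := pow_dvd_of_algebraMap_eq (y := -y) (by
    rw [map_mul]; linear_combination hx)
  have hb : b = a ^ n * c := by
    refine (mul_cancel_right_mem_nonZeroDivisors ha).1 ?_
    rw [hc]; ring
  rw [hb, map_mul, map_pow, ← mul_add, ← map_pow, map_mul, evalₐ_algebraMap,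
    (Ideal.Quotient.eq_zero_iff_mem).2 (Ideal.pow_mem_pow (Ideal.mem_span_singleton_self a) n),
    zero_mul]
  exact (_root_.map_zero (evalₐ _ n)).symm

/-- A ring homomorphism inducing isomorphisms modulo all powers of `b` and its image `c` induces
an isomorphism between the completions. -/
theorem exists_ringEquiv_of_dvd (φ : B →+* C) (b : B) (c : C) (hbc : φ b = c)
    (hsurj : ∀ x, ∃ y z, x = φ y + c * z) (hinj : ∀ n y, c ^ n ∣ φ y → b ^ n ∣ y) :
    ∃ e : AdicCompletion (Ideal.span {b}) B ≃+* AdicCompletion (Ideal.span {c}) C,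
      ∀ y, e (algebraMap B _ y) = algebraMap C _ (φ y) := by
  have hsurj' (n : ℕ) : ∀ x, ∃ y z, x = φ y + c ^ n * z := by
    induction n with
    | zero => exact fun x ↦ ⟨0, x, by simp⟩
    | succ n ih =>
      intro x
      obtain ⟨y, z, rfl⟩ := ih x
      obtain ⟨y', z', rfl⟩ := hsurj z
      exact ⟨y + b ^ n * y', z', by rw [map_add, map_mul, map_pow, hbc]; ring⟩
  have hle (n : ℕ) : Ideal.span {b} ^ n ≤ (Ideal.span {c} ^ n).comap φ := by
    rw [Ideal.span_singleton_pow, Ideal.span_singleton_pow, Ideal.span_singleton_le_iff_mem,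
      Ideal.mem_comap, map_pow, hbc]
    exact Ideal.mem_span_singleton_self _
  have hbij (n : ℕ) : Function.Bijective (Ideal.quotientMap (Ideal.span {c} ^ n) φ (hle n)) := by
    constructor
    · refine Ideal.quotientMap_injective' fun y hy ↦ ?_
      rw [Ideal.mem_comap, Ideal.span_singleton_pow, Ideal.mem_span_singleton] at hy
      rw [Ideal.span_singleton_pow, Ideal.mem_span_singleton]
      exact hinj n y hy
    · intro x
      obtain ⟨x, rfl⟩ := Ideal.Quotient.mk_surjective x
      obtain ⟨y, z, rfl⟩ := hsurj' n x
      refine ⟨Ideal.Quotient.mk _ y, ?_⟩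
      rw [Ideal.quotientMap_mk, Ideal.Quotient.eq, Ideal.span_singleton_pow,
        Ideal.mem_span_singleton]
      exact ⟨-z, by ring⟩
  let q (n : ℕ) := RingEquiv.ofBijective _ (hbij n)
  have hq {m n : ℕ} (h : m ≤ n) (y) :
      Ideal.Quotient.factorPow (Ideal.span {c}) h (q n y) =
        q m (Ideal.Quotient.factorPow (Ideal.span {b}) h y) := by
    obtain ⟨y, rfl⟩ := Ideal.Quotient.mk_surjective y
    simp [q]
  let F := liftRingHom (Ideal.span {c})
    (fun n ↦ (q n).toRingHom.comp (evalₐ (Ideal.span {b}) n).toRingHom) (fun {m n} h ↦ by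
      ext x
      exact (hq h _).trans (congrArg (q m) (factorPow_evalₐ _ h x)))
  let G := liftRingHom (Ideal.span {b})
    (fun n ↦ (q n).symm.toRingHom.comp (evalₐ (Ideal.span {c}) n).toRingHom) (fun {m n} h ↦ by
      ext x
      refine (q m).injective ((Eq.trans ?_ ((q m).apply_symm_apply _).symm))
      change q m (Ideal.Quotient.factorPow _ h ((q n).symm (evalₐ _ n x))) = evalₐ _ m x
      rw [← hq, RingEquiv.apply_symm_apply, factorPow_evalₐ])
  have hF (n x) : evalₐ _ n (F x) = q n (evalₐ _ n x) := evalₐ_liftRingHom ..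
  have hG (n x) : evalₐ _ n (G x) = (q n).symm (evalₐ _ n x) := evalₐ_liftRingHom ..
  refine ⟨RingEquiv.ofRingHom F G ?_ ?_, fun y ↦ ext_evalₐ fun n ↦ ?_⟩
  · exact RingHom.ext fun x ↦ ext_evalₐ fun n ↦ by simp [hF, hG]
  · exact RingHom.ext fun x ↦ ext_evalₐ fun n ↦ by simp [hF, hG]
  · rw [RingEquiv.ofRingHom_apply, hF, evalₐ_algebraMap, evalₐ_algebraMap]
    simp [q]

end AdicCompletion

section IntegralEquations

variable {R K : Type*} [CommRing R] [CommRing K] [Algebra R K]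

theorem IsIntegral.exists_pow_add_sum_eq_zero {x : K} (hx : IsIntegral R x) :
    ∃ (d : ℕ) (c : ℕ → R),
      x ^ (d + 1) + ∑ i ∈ Finset.range (d + 1), algebraMap R K (c i) * x ^ i = 0 := by
  obtain ⟨p, hp, hpx⟩ := hx
  refine ⟨p.natDegree, fun i ↦ i.casesOn 0 p.coeff, ?_⟩
  rw [hp.as_sum] at hpx
  simp only [Polynomial.eval₂_add, Polynomial.eval₂_finsetSum, Polynomial.eval₂_mul,
    Polynomial.eval₂_pow, Polynomial.eval₂_X, Polynomial.eval₂_C] at hpx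
  rw [Finset.sum_range_succ', ← zero_mul x, ← hpx, add_mul, Finset.sum_mul]
  simp [pow_succ, mul_assoc]

theorem isIntegral_of_pow_add_sum_eq {x : K} {d : ℕ} {c : ℕ → R} {r : R}
    (h : x ^ (d + 1) + ∑ i ∈ Finset.range (d + 1), algebraMap R K (c i) * x ^ i =
      algebraMap R K r) : IsIntegral R x := by
  nontriviality R
  refine ⟨Polynomial.X ^ (d + 1) +
    (∑ i ∈ Finset.range (d + 1), Polynomial.C (c i) * Polynomial.X ^ i - Polynomial.C r), ?_, ?_⟩
  · refine Polynomial.monic_X_pow_add ((Polynomial.degree_sub_le _ _).trans_lt (max_lt ?_ ?_))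
    · refine (Polynomial.degree_sum_le _ _).trans_lt
        ((Finset.sup_lt_iff (WithBot.bot_lt_coe _)).2 fun i hi ↦ ?_)
      exact (Polynomial.degree_C_mul_X_pow_le _ _).trans_lt
        (WithBot.coe_lt_coe.2 (Finset.mem_range.1 hi))
    · exact Polynomial.degree_C_le.trans_lt (WithBot.coe_lt_coe.2 d.succ_pos)
  · simp only [Polynomial.eval₂_add, Polynomial.eval₂_sub, Polynomial.eval₂_finsetSum,
      Polynomial.eval₂_mul, Polynomial.eval₂_pow, Polynomial.eval₂_X, Polynomial.eval₂_C]
    rw [← h]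
    ring

end IntegralEquations

section Approximation

variable {R S K L : Type*} [CommRing R] [CommRing S] [CommRing K] [CommRing L]
  [Algebra R K] [Algebra S L]

theorem IsLocalization.Away.exists_algebraMap_mul_eq (a : R) [IsLocalization.Away a K] (n : ℕ)
    (x : K) : ∃ y : K, algebraMap R K a ^ n * y = x := by
  have ha := (IsLocalization.Away.algebraMap_isUnit (S := K) a).pow n
  exact (ha.dvd (a := x)).imp fun _ ↦ Eq.symm

/-- `S` behaves like the `a`-adic completion of `R[1/f]`: it is `a`-torsion-free, `f` is invertible
in it, and it has the same quotients by the powers of `a`. -/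
structure IsAdicApproxAway (ι : R →+* S) (a f : R) : Prop where
  mem_nonZeroDivisors : ι a ∈ nonZeroDivisors S
  isUnit : IsUnit (ι f)
  exists_eq_add (n : ℕ) (s : S) : ∃ m r t, ι f ^ m * s = ι r + ι a ^ n * t
  exists_pow_dvd (n : ℕ) (r : R) : ι a ^ n ∣ ι r → ∃ j, a ^ n ∣ f ^ j * r

namespace IsAdicApproxAway

variable {ι : R →+* S} {a f : R} (h : IsAdicApproxAway ι a f)
include h

theorem exists_common_eq_add (n d : ℕ) (s : ℕ → S) :
    ∃ (m : ℕ) (r : ℕ → R) (t : ℕ → S), ∀ i < d, ι f ^ m * s i = ι (r i) + ι a ^ n * t i := by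
  choose m r t hs using fun i ↦ h.exists_eq_add n (s i)
  refine ⟨∑ i ∈ Finset.range d, m i, fun i ↦ f ^ (∑ i ∈ Finset.range d, m i - m i) * r i,
    fun i ↦ ι f ^ (∑ i ∈ Finset.range d, m i - m i) * t i, fun i hi ↦ ?_⟩
  have hle : m i ≤ ∑ i ∈ Finset.range d, m i :=
    Finset.single_le_sum (fun _ _ ↦ Nat.zero_le _) (Finset.mem_range.2 hi)
  obtain ⟨k, hk⟩ := Nat.exists_eq_add_of_le hle
  dsimp only
  rw [hk, Nat.add_sub_cancel_left, pow_add, map_mul, map_pow]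
  linear_combination ι f ^ k * hs i

variable [IsLocalization.Away a K] [IsLocalization.Away (ι a) L] {ψ : K →+* L}
  (hψ : ∀ r, ψ (algebraMap R K r) = algebraMap S L (ι r))
include hψ

theorem exists_pow_mul_eq_algebraMap {z : K} {s : S} (hz : ψ z = algebraMap S L s) :
    ∃ j r, algebraMap R K f ^ j * z = algebraMap R K r := by
  obtain ⟨n, r, hr⟩ := IsLocalization.Away.surj a z
  have hinj : Function.Injective (algebraMap S L) :=
    IsLocalization.injective L (Submonoid.powers_le.2 h.mem_nonZeroDivisors)
  obtain ⟨j, r', hj⟩ := h.exists_pow_dvd n r ⟨s, hinj (by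
    rw [← hψ, ← hr, map_mul, map_mul, map_pow, map_pow, hψ, hz, mul_comm])⟩
  refine ⟨j, r', ((IsLocalization.Away.algebraMap_isUnit (S := K) a).pow n).mul_left_cancel ?_⟩
  rw [← map_pow, ← map_mul _ _ r', ← hj, map_mul, ← hr, map_pow, map_pow]
  ring

theorem exists_isIntegral_pow_mul {w : K} (hw : IsIntegral S (ψ w)) :
    ∃ j, IsIntegral R (algebraMap R K f ^ j * w) := by
  obtain ⟨d, c, hc⟩ := hw.exists_pow_add_sum_eq_zero
  obtain ⟨n, b, hb⟩ := IsLocalization.Away.surj a w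
  obtain ⟨m, r, t, hr⟩ := h.exists_common_eq_add (n * d) (d + 1) c
  set F := algebraMap R K f with hF
  set u := F ^ m * w with hu
  obtain ⟨j, r', hj⟩ := h.exists_pow_mul_eq_algebraMap (K := K) hψ
    (z := u ^ (d + 1) + ∑ i ∈ Finset.range (d + 1), F ^ (m * (d - i)) * algebraMap R K (r i) * u ^ i)
    (s := - ∑ i ∈ Finset.range (d + 1), ι f ^ (m * d) * t i * ι a ^ (n * (d - i)) * ι b ^ i) (by
    have hψb := congrArg ψ hb
    simp only [map_mul, map_pow, hψ] at hψb
    simp only [hu, hF, map_add, map_sum, map_mul, map_pow, hψ, map_neg]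
    rw [eq_neg_iff_add_eq_zero, add_assoc, ← Finset.sum_add_distrib,
      ← mul_zero (algebraMap S L (ι f) ^ (m * (d + 1))), ← hc, mul_add, Finset.mul_sum]
    congr 1
    · ring
    refine Finset.sum_congr rfl fun i hi ↦ ?_
    obtain ⟨k, rfl⟩ := Nat.exists_eq_add_of_le (Nat.lt_succ_iff.1 (Finset.mem_range.1 hi))
    have hri := congrArg (algebraMap S L) (hr i (Finset.mem_range.1 hi))
    simp only [map_mul, map_pow, map_add] at hri
    rw [Nat.add_sub_cancel_left, ← hψb]
    linear_combination (-algebraMap S L (ι f) ^ (m * (i + k)) * ψ w ^ i) * hri)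
  refine ⟨j + m, isIntegral_of_pow_add_sum_eq (d := d)
    (c := fun i ↦ f ^ (j * (d + 1 - i)) * f ^ (m * (d - i)) * r i) (r := f ^ (j * d) * r') ?_⟩
  rw [map_mul, ← hj, map_pow, ← hF, ← mul_assoc, ← pow_add, mul_add, Finset.mul_sum]
  congr 1
  · rw [hu]; ring
  refine Finset.sum_congr rfl fun i hi ↦ ?_
  obtain ⟨k, rfl⟩ := Nat.exists_eq_add_of_le (Nat.lt_succ_iff.1 (Finset.mem_range.1 hi))
  rw [hu, Nat.add_sub_cancel_left, add_assoc, Nat.add_sub_cancel_left]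
  simp only [map_mul, map_pow, ← hF]
  ring

theorem exists_ringHom_integralClosure (B : Type*) [CommRing B] [Algebra (integralClosure R K) B]
    [IsLocalization.Away (algebraMap R (integralClosure R K) f) B] :
    ∃ φ : B →+* integralClosure S L,
      (∀ r, φ (algebraMap _ B (algebraMap R (integralClosure R K) r)) = algebraMap S _ (ι r)) ∧
      (∀ x, ∃ y z, x = φ y + algebraMap S _ (ι a) * z) ∧
      ∀ n y, algebraMap S _ (ι a) ^ n ∣ φ y →
        algebraMap _ B (algebraMap R (integralClosure R K) a) ^ n ∣ y := by
  set f' := algebraMap R (integralClosure R K) f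
  let ρ : integralClosure R K →+* integralClosure S L :=
    (ψ.comp (integralClosure R K).val.toRingHom).codRestrict (integralClosure S L)
      fun x ↦ IsIntegral.map_of_comp_eq ι ψ (by ext r; simp [hψ]) x.2
  have hρ (r : R) : ρ (algebraMap R _ r) = algebraMap S _ (ι r) := Subtype.ext (hψ r)
  have hρcoe (x) : (ρ x : L) = ψ x := rfl
  have hf : IsUnit (algebraMap S (integralClosure S L) (ι f)) := h.isUnit.map _
  let φ : B →+* integralClosure S L := IsLocalization.Away.lift f' (g := ρ) (by rwa [hρ])
  have hφ (x) : φ (algebraMap _ B x) = ρ x := IsLocalization.Away.lift_eq _ _ x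
  have hfB := IsLocalization.Away.algebraMap_isUnit (S := B) f'
  have ha := IsLocalization.Away.algebraMap_isUnit (S := L) (ι a)
  refine ⟨φ, fun r ↦ by rw [hφ, hρ], fun x ↦ ?_, fun n y ↦ ?_⟩
  · obtain ⟨n, s, hs⟩ := IsLocalization.Away.surj (ι a) (x : L)
    obtain ⟨m, r, t, hr⟩ := h.exists_eq_add (n + 1) s
    obtain ⟨y, hy⟩ := IsLocalization.Away.exists_algebraMap_mul_eq a n (algebraMap R K r)
    have hψy : ψ y = algebraMap S L (ι f) ^ m * x - algebraMap S L (ι a) * algebraMap S L t := by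
      refine (ha.pow n).mul_left_cancel ?_
      have hy' := congrArg ψ hy
      have hr' := congrArg (algebraMap S L) hr
      simp only [map_mul, map_pow, map_add, hψ] at hy' hr'
      linear_combination hy' - hr' - algebraMap S L (ι f) ^ m * hs
    obtain ⟨j, hj⟩ := h.exists_isIntegral_pow_mul (K := K) (w := y) hψ (by
      rw [hψy, ← map_pow, ← map_mul]
      exact (isIntegral_algebraMap.mul x.2).sub isIntegral_algebraMap)
    obtain ⟨β, hβ⟩ := (hfB.pow (j + m)).dvd (a := algebraMap (integralClosure R K) B ⟨_, hj⟩)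
    obtain ⟨z, hz⟩ := (hf.pow m).dvd (a := algebraMap S (integralClosure S L) t)
    refine ⟨β, z, (hf.pow (j + m)).mul_left_cancel ?_⟩
    have hβ' := congrArg φ hβ
    rw [map_mul, map_pow, hφ, hφ, hρ] at hβ'
    have hρy : ρ ⟨_, hj⟩ = algebraMap S _ (ι f) ^ j *
        (algebraMap S _ (ι f) ^ m * x - algebraMap S _ (ι a) * algebraMap S _ t) := by
      refine Subtype.ext ?_
      rw [hρcoe, map_mul, map_pow, hψ, hψy]
      rfl
    rw [hρy] at hβ'
    linear_combination hβ' + (algebraMap S _ (ι f) ^ j * algebraMap S _ (ι a)) * hz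
  · rintro ⟨z, hz⟩
    obtain ⟨k, β, hβ⟩ := IsLocalization.Away.surj f' y
    obtain ⟨w, hw⟩ := IsLocalization.Away.exists_algebraMap_mul_eq a n (β : K)
    have hψw : ψ w = algebraMap S L (ι f) ^ k * z := by
      refine (ha.pow n).mul_left_cancel ?_
      have hβ' := congrArg φ hβ
      rw [map_mul, map_pow, hφ, hφ, hz, hρ] at hβ'
      have hβL := congrArg (algebraMap (integralClosure S L) L) hβ'
      have hw' := congrArg ψ hw
      simp only [map_mul, map_pow, hψ, ← IsScalarTower.algebraMap_apply] at hw' hβL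
      change _ * (z : L) * _ = ψ β at hβL
      linear_combination hw' - hβL
    obtain ⟨j, hj⟩ := h.exists_isIntegral_pow_mul (K := K) (w := w) hψ (by
      rw [hψw, ← map_pow]
      exact isIntegral_algebraMap.mul z.2)
    have hγ : f' ^ j * β = algebraMap R _ a ^ n * ⟨_, hj⟩ := by
      refine Subtype.ext ?_
      change algebraMap R K f ^ j * (β : K) = algebraMap R K a ^ n * (algebraMap R K f ^ j * w)
      rw [← hw]
      ring
    refine (hfB.pow (k + j)).dvd_mul_right.1 ⟨algebraMap (integralClosure R K) B ⟨_, hj⟩, ?_⟩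
    have hγB := congrArg (algebraMap (integralClosure R K) B) hγ
    simp only [map_mul, map_pow] at hγB
    linear_combination hγB + algebraMap _ B f' ^ j * hβ

end IsAdicApproxAway

theorem AdicCompletion.isAdicApproxAway {a : R} (ha : a ∈ nonZeroDivisors R) (f : R) :
    IsAdicApproxAway
      ((algebraMap (Localization.Away f) (AdicCompletion
        (Ideal.span {algebraMap R (Localization.Away f) a}) (Localization.Away f))).comp
        (algebraMap R (Localization.Away f))) a f where
  mem_nonZeroDivisors := algebraMap_mem_nonZeroDivisors
    (IsLocalization.map_nonZeroDivisors_le (Submonoid.powers f) _ ⟨a, ha, rfl⟩)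
  isUnit := (IsLocalization.Away.algebraMap_isUnit f).map
    (algebraMap (Localization.Away f) (AdicCompletion _ (Localization.Away f)))
  exists_eq_add n s := by
    obtain ⟨b, t, rfl⟩ := exists_eq_algebraMap_add _ n s
    obtain ⟨m, r, hr⟩ := IsLocalization.Away.surj f b
    refine ⟨m, r, algebraMap (Localization.Away f) _ (algebraMap R _ f) ^ m * t, ?_⟩
    simp only [RingHom.comp_apply]
    rw [← hr, map_mul, map_pow]
    ring
  exists_pow_dvd n r := by
    rintro ⟨t, ht⟩
    obtain ⟨b, hb⟩ := pow_dvd_of_algebraMap_eq ht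
    obtain ⟨m, s, hs⟩ := IsLocalization.Away.surj f b
    have : algebraMap R (Localization.Away f) (f ^ m * r) = algebraMap R _ (a ^ n * s) := by
      rw [map_mul, hb, map_mul, ← hs, map_pow, map_pow]
      ring
    obtain ⟨⟨_, k, rfl⟩, hk⟩ := IsLocalization.exists_of_eq (M := Submonoid.powers f) this
    dsimp only at hk
    exact ⟨k + m, f ^ k * s, by linear_combination hk⟩

end Approximation

/-- Let `R` be a `π`-adically complete, `π`-torsion-free commutative ring and
`f ∈ R`.  Let `R̄` be the integral closure of `R` in `R[1/π]`, `S = R⟨1/f⟩` the `π`-adic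
completion of `R[1/f]`, and `S̄` the integral closure of `S` in `S[1/π]`.  Then the
`π`-adic completion of `R̄[1/f]` is canonically isomorphic to the `π`-adic completion of
`S̄`, compatibly with the natural maps from `R`. -/
theorem stmt6 {R : Type*} [CommRing R] (π : R) (hπ : π ∈ nonZeroDivisors R)
    [IsAdicComplete (Ideal.span {π}) R] (f : R) :
    ∃ e : piComplAway (intClAway R π) (algebraMap R (intClAway R π) π)
            (algebraMap R (intClAway R π) f) ≃+*
          intClAwayCompl (piComplAway R π f) (piInComplAway R π f),
      ∀ r : R,
        e (algebraMap (Localization.Away (algebraMap R (intClAway R π) f))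
            (piComplAway (intClAway R π) (algebraMap R (intClAway R π) π)
              (algebraMap R (intClAway R π) f))
            (algebraMap (intClAway R π)
              (Localization.Away (algebraMap R (intClAway R π) f))
              (algebraMap R (intClAway R π) r))) =
          fromBase (piComplAway R π f) (piInComplAway R π f)
            (algebraMap (Localization.Away f) (piComplAway R π f)
              (algebraMap R (Localization.Away f) r)) := by
  let ι := (algebraMap (Localization.Away f) (piComplAway R π f)).comp
    (algebraMap R (Localization.Away f))
  have h : IsAdicApproxAway ι π f := AdicCompletion.isAdicApproxAway hπ f
  have : IsLocalization.Away (ι π) (Localization.Away (piInComplAway R π f)) :=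
    inferInstanceAs (IsLocalization.Away (piInComplAway R π f) _)
  let ψ : Localization.Away π →+* Localization.Away (piInComplAway R π f) :=
    IsLocalization.Away.map _ _ ι π
  have hψ (r : R) : ψ (algebraMap R _ r) = algebraMap _ _ (ι r) := IsLocalization.map_eq _ r
  obtain ⟨φ, hφ, hsurj, hinj⟩ := h.exists_ringHom_integralClosure hψ
    (Localization.Away (algebraMap R (intClAway R π) f))
  obtain ⟨e, he⟩ := AdicCompletion.exists_ringEquiv_of_dvd φ _ _ (hφ π) hsurj hinj
  exact ⟨e, fun r ↦ (he _).trans (congrArg _ (hφ r))⟩
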